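/- arXiv:1508.02260 — 3 statements merged into one kernel-verified Lean document; each statement's English description precedes it below -/
import Mathlib

section
/- Let λ = (λ₁,λ₂) be positive rational weights, Y a nonzero weighted homogeneous holomorphic polynomial vector field of weighted degree δ > 0, and ν a rational number. For n ∈ ℕ let V_n := { X ∈ ℂ[z₁,z₂] : X is weighted homogeneous of weighted degree ν and Yⁿ(X) = 0 }, where Yⁿ denotes Y applied n times. Then V_n is a ℂ-vector space of dimension at most n. -/
open MvPolynomial Complex

noncomputable section

/-- Polynomials in two complex variables `z₁, z₂`. -/
abbrev P2 := MvPolynomial (Fin 2) ℂ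

/-- Action of the vector field `Y = f₀ ∂/∂z₁ + f₁ ∂/∂z₂` on `ℂ[z₁,z₂]`. -/
def vf (f : Fin 2 → P2) (q : P2) : P2 :=
  f 0 * pderiv 0 q + f 1 * pderiv 1 q

theorem coeff_X_mul_pderiv {σ R : Type*} [CommSemiring R] (i : σ) (p : MvPolynomial σ R)
    (m : σ →₀ ℕ) : coeff m (X i * pderiv i p) = m i * coeff m p := by
  classical
  induction p using MvPolynomial.induction_on' with
  | monomial a r =>
    rw [X_mul_pderiv_monomial, coeff_smul, coeff_monomial]
    split_ifs with h
    · subst h; simp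
    · simp
  | add p q hp hq => simp only [map_add, mul_add, coeff_add, hp, hq]

theorem MonomialOrder.degree_X_mul_pderiv_le {σ R : Type*} [CommSemiring R]
    (ord : MonomialOrder σ) (i : σ) (p : MvPolynomial σ R) :
    ord.toSyn (ord.degree (X i * pderiv i p)) ≤ ord.toSyn (ord.degree p) := by
  refine ord.degree_le_iff.mpr fun b hb => ord.le_degree ?_
  rw [mem_support_iff, coeff_X_mul_pderiv] at hb
  exact mem_support_iff.mpr (right_ne_zero_of_mul hb)

/-- If the Jacobian of two nonzero polynomials in two variables vanishes, the exponents of their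
leading monomials are parallel. -/
theorem degree_parallel_of_jacobian_eq_zero (ord : MonomialOrder (Fin 2)) {p q : P2}
    (hp : p ≠ 0) (hq : q ≠ 0) (h : pderiv 0 p * pderiv 1 q = pderiv 1 p * pderiv 0 q) :
    ord.degree p 0 * ord.degree q 1 = ord.degree p 1 * ord.degree q 0 := by
  have h' : (X 0 * pderiv 0 p) * (X 1 * pderiv 1 q) =
      (X 1 * pderiv 1 p) * (X 0 * pderiv 0 q) := by
    linear_combination (X 0 * X 1 : P2) * h
  have hc := congrArg (coeff (ord.degree p + ord.degree q)) h'
  rw [MonomialOrder.coeff_mul_of_add_of_degree_le (ord.degree_X_mul_pderiv_le 0 p)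
      (ord.degree_X_mul_pderiv_le 1 q),
    MonomialOrder.coeff_mul_of_add_of_degree_le (ord.degree_X_mul_pderiv_le 1 p)
      (ord.degree_X_mul_pderiv_le 0 q)] at hc
  simp only [coeff_X_mul_pderiv] at hc
  have hp' : coeff (ord.degree p) p ≠ 0 := ord.leadingCoeff_ne_zero_iff.mpr hp
  have hq' : coeff (ord.degree q) q ≠ 0 := ord.leadingCoeff_ne_zero_iff.mpr hq
  have : ((ord.degree p 0 * ord.degree q 1 : ℕ) : ℂ) = (ord.degree p 1 * ord.degree q 0 : ℕ) := by
    push_cast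
    refine mul_right_cancel₀ (mul_ne_zero hp' hq') ?_
    linear_combination hc
  exact_mod_cast this

theorem eq_of_parallel_of_weight_eq {lam : Fin 2 → ℚ} (hlam : ∀ j, 0 < lam j)
    {a b : Fin 2 →₀ ℕ} (h : a 0 * b 1 = a 1 * b 0)
    (hw : Finsupp.weight lam a = Finsupp.weight lam b) : a = b := by
  rw [Finsupp.weight_apply, Finsupp.weight_apply, Finsupp.sum_fintype _ _ (by simp),
    Finsupp.sum_fintype _ _ (by simp)] at hw
  simp only [Fin.sum_univ_two, nsmul_eq_mul] at hw
  have h' : (a 0 : ℚ) * b 1 = a 1 * b 0 := by exact_mod_cast h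
  have h0 := hlam 0
  have h1 := hlam 1
  have ha0 : (0 : ℚ) ≤ a 0 := Nat.cast_nonneg _
  have ha1 : (0 : ℚ) ≤ a 1 := Nat.cast_nonneg _
  have hb0 : (0 : ℚ) ≤ b 0 := Nat.cast_nonneg _
  have hb1 : (0 : ℚ) ≤ b 1 := Nat.cast_nonneg _
  have key : ((a 0 : ℚ) = b 0) ∧ ((a 1 : ℚ) = b 1) := by
    by_cases hν : (a 0 : ℚ) * lam 0 + a 1 * lam 1 = 0
    · have e1 := (add_eq_zero_iff_of_nonneg (by positivity) (by positivity)).mp hν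
      have e2 := (add_eq_zero_iff_of_nonneg (by positivity) (by positivity)).mp (hw ▸ hν)
      simp only [mul_eq_zero, h0.ne', h1.ne', or_false] at e1 e2
      exact ⟨e1.1.trans e2.1.symm, e1.2.trans e2.2.symm⟩
    · constructor <;> refine mul_right_cancel₀ hν ?_
      · linear_combination (a 0 : ℚ) * hw + lam 1 * h'
      · linear_combination (a 1 : ℚ) * hw - lam 0 * h'
  ext i
  fin_cases i
  · exact_mod_cast key.1
  · exact_mod_cast key.2

/-- The action of a vector field as a linear map. -/
def vfLinear (f : Fin 2 → P2) : P2 →ₗ[ℂ] P2 :=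
  LinearMap.mulLeft ℂ (f 0) ∘ₗ (pderiv 0).toLinearMap +
    LinearMap.mulLeft ℂ (f 1) ∘ₗ (pderiv 1).toLinearMap

theorem coe_vfLinear (f : Fin 2 → P2) : ⇑(vfLinear f) = vf f := rfl

theorem jacobian_eq_zero_of_vf_eq_zero {f : Fin 2 → P2} (hf : f ≠ 0) {p q : P2}
    (hp : vf f p = 0) (hq : vf f q = 0) :
    pderiv 0 p * pderiv 1 q = pderiv 1 p * pderiv 0 q := by
  unfold vf at hp hq
  obtain ⟨i, hi⟩ := Function.ne_iff.mp hf
  refine mul_left_cancel₀ hi ?_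
  fin_cases i
  · change f 0 * _ = f 0 * _
    linear_combination pderiv 1 q * hp - pderiv 1 p * hq
  · change f 1 * _ = f 1 * _
    linear_combination pderiv 0 p * hq - pderiv 0 q * hp

/-- First integrals of a given weighted degree are unique up to scalars. -/
theorem exists_smul_eq_of_vf_eq_zero {lam : Fin 2 → ℚ} (hlam : ∀ j, 0 < lam j)
    {f : Fin 2 → P2} (hf : f ≠ 0) {ν : ℚ} {p q : P2} (hp0 : p ≠ 0)
    (hp : IsWeightedHomogeneous lam p ν) (hq : IsWeightedHomogeneous lam q ν)
    (hvp : vf f p = 0) (hvq : vf f q = 0) : ∃ c : ℂ, c • p = q := by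
  let ord : MonomialOrder (Fin 2) := MonomialOrder.lex
  have hlc : coeff (ord.degree p) p ≠ 0 := ord.leadingCoeff_ne_zero_iff.mpr hp0
  set c : ℂ := coeff (ord.degree p) q / coeff (ord.degree p) p with hc
  refine ⟨c, ?_⟩
  by_contra hne
  have hr0 : q - c • p ≠ 0 := sub_ne_zero.mpr (Ne.symm hne)
  have hr : IsWeightedHomogeneous lam (q - c • p) ν :=
    (weightedHomogeneousSubmodule ℂ lam ν).sub_mem hq (Submodule.smul_mem _ c hp)
  have hvr : vf f (q - c • p) = 0 := by
    rw [← coe_vfLinear, map_sub, map_smul, coe_vfLinear, hvp, hvq, smul_zero, sub_zero]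
  have hlr : coeff (ord.degree (q - c • p)) (q - c • p) ≠ 0 :=
    ord.leadingCoeff_ne_zero_iff.mpr hr0
  have hdeg := eq_of_parallel_of_weight_eq hlam
    (degree_parallel_of_jacobian_eq_zero ord hp0 hr0
      (jacobian_eq_zero_of_vf_eq_zero hf hvp hvr)) ((hp hlc).trans (hr hlr).symm)
  apply hlr
  rw [← hdeg, coeff_sub, coeff_smul, smul_eq_mul, hc, div_mul_cancel₀ _ hlc, sub_self]

theorem vf_isWeightedHomogeneous {lam : Fin 2 → ℚ} {f : Fin 2 → P2} {δ ν : ℚ}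
    (hfhom : ∀ j, IsWeightedHomogeneous lam (f j) (lam j + δ)) {p : P2}
    (hp : IsWeightedHomogeneous lam p ν) : IsWeightedHomogeneous lam (vf f p) (ν + δ) := by
  have h (j : Fin 2) : IsWeightedHomogeneous lam (f j * pderiv j p) (ν + δ) := by
    have := (hfhom j).mul (hp.pderiv (i := j) (sub_add_cancel ν (lam j)))
    rwa [show lam j + δ + (ν - lam j) = ν + δ by ring] at this
  exact (h 0).add (h 1)

/-- Weighted homogeneous polynomials of degree `ν` killed by the `n`-th power of a
vector field. -/
def iterKer (lam : Fin 2 → ℚ) (f : Fin 2 → P2) (ν : ℚ) (n : ℕ) : Submodule ℂ P2 :=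
  weightedHomogeneousSubmodule ℂ lam ν ⊓ LinearMap.ker (vfLinear f ^ n)

theorem mem_iterKer {lam : Fin 2 → ℚ} {f : Fin 2 → P2} {ν : ℚ} {n : ℕ} {p : P2} :
    p ∈ iterKer lam f ν n ↔ IsWeightedHomogeneous lam p ν ∧ (vf f)^[n] p = 0 := by
  rw [iterKer, Submodule.mem_inf, mem_weightedHomogeneousSubmodule, LinearMap.mem_ker,
    Module.End.pow_apply, coe_vfLinear]

theorem rank_iterKer_le {lam : Fin 2 → ℚ} (hlam : ∀ j, 0 < lam j)
    {f : Fin 2 → P2} (hf : f ≠ 0) {δ : ℚ}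
    (hfhom : ∀ j, IsWeightedHomogeneous lam (f j) (lam j + δ)) (ν : ℚ) (n : ℕ) :
    Module.rank ℂ (iterKer lam f ν n) ≤ n := by
  induction n generalizing ν with
  | zero =>
    have h : iterKer lam f ν 0 = ⊥ :=
      (Submodule.eq_bot_iff _).mpr fun p hp => (mem_iterKer.mp hp).2
    rw [h, rank_bot, Nat.cast_zero]
  | succ n ih =>
    let φ := (vfLinear f).domRestrict (iterKer lam f ν (n + 1))
    have hrange : LinearMap.range φ ≤ iterKer lam f (ν + δ) n := by
      rintro _ ⟨⟨p, hp⟩, rfl⟩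
      obtain ⟨hp, hpn⟩ := mem_iterKer.mp hp
      exact mem_iterKer.mpr ⟨vf_isWeightedHomogeneous hfhom hp, hpn⟩
    have hker : Module.rank ℂ (LinearMap.ker φ) ≤ 1 := by
      by_cases hbot : LinearMap.ker φ = ⊥
      · rw [hbot, rank_bot]
        exact zero_le_one
      obtain ⟨p, hp, hp0⟩ := Submodule.exists_mem_ne_zero_of_ne_bot hbot
      have hspan : LinearMap.ker φ ≤ Submodule.span ℂ {p} := by
        refine fun q hq => Submodule.mem_span_singleton.mpr ?_
        obtain ⟨c, hc⟩ := exists_smul_eq_of_vf_eq_zero hlam hf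
          (fun h => hp0 (Subtype.ext h)) (mem_iterKer.mp p.2).1 (mem_iterKer.mp q.2).1 hp hq
        exact ⟨c, Subtype.ext hc⟩
      exact (Submodule.rank_mono hspan).trans
        ((rank_span_le _).trans_eq (Cardinal.mk_singleton p))
    rw [← LinearMap.rank_range_add_rank_ker φ, Nat.cast_succ]
    exact add_le_add ((Submodule.rank_mono hrange).trans (ih _)) hker

/-- `V_n = {X weighted homogeneous of weighted degree ν : Yⁿ(X) = 0}`
has complex dimension at most `n`, for `Y` a nonzero weighted homogeneous vector
field of positive weighted degree. -/
theorem stmt2 (lam : Fin 2 → ℚ) (hlam : ∀ j, 0 < lam j)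
    (f : Fin 2 → P2) (hf : f ≠ 0) (δ : ℚ) (hδ : 0 < δ)
    (hfhom : ∀ j, IsWeightedHomogeneous lam (f j) (lam j + δ))
    (ν : ℚ) (n : ℕ) :
    Module.rank ℂ
      ↥(Submodule.span ℂ
        {X : P2 | IsWeightedHomogeneous lam X ν ∧ (vf f)^[n] X = 0}) ≤ n := by
  refine (Submodule.rank_mono (Submodule.span_le.mpr fun p hp => ?_)).trans
    (rank_iterKer_le hlam hf hfhom ν n)
  exact mem_iterKer.mpr hp
end
end

section
/- Let M_P be a holomorphically nondegenerate model hypersurface and let Y = f₁∂/∂z₁ + f₂∂/∂z₂ be a generalized rotation of M_P. Then there exist an integer N ≥ 2, a Hermitian N×N complex matrix A = (a_{lm}), a complex N×N matrix C = (c_{lm}), and holomorphic polynomials F₁,…,F_N ∈ ℂ[z₁,z₂] such that: (i) P(z,z̄) = Σ_{l,m=1}^{N} a_{lm} F_l(z) · conj(F_m(z)) for all z ∈ ℂ², so the polynomial map f(z,w) = (F₁(z),…,F_N(z),w) maps M_P into the hyperquadric H = {(ζ,η) ∈ ℂ^N×ℂ : Im η = Σ_{l,m} a_{lm} ζ_l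 conj(ζ_m)}; (ii) Re( Σ_{l,m=1}^{N} a_{lm} (Cζ)_l · conj(ζ_m) ) = 0 for all ζ ∈ ℂ^N, so the linear vector field Z = Σ_l (Cζ)_l ∂/∂ζ_l is an infinitesimal CR automorphism of H; and (iii) f₁ ∂F_l/∂z₁ + f₂ ∂F_l/∂z₂ = Σ_{m=1}^{N} c_{lm} F_m for every l, i.e., Y is f-related to Z. -/
open MvPolynomial Complex

noncomputable section

/-- Polynomials in `z₁, z₂` (indexed by `Sum.inl`) and the antiholomorphic
variables `z̄₁, z̄₂` (indexed by `Sum.inr`). -/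
abbrev P4 := MvPolynomial (Fin 2 ⊕ Fin 2) ℂ

/-- Substitution `(z, z̄)`. -/
def mix (z : Fin 2 → ℂ) : Fin 2 ⊕ Fin 2 → ℂ :=
  Sum.elim z (fun j => (starRingEnd ℂ) (z j))

/-- Complex conjugation of the coefficients of a polynomial. -/
def conjPoly {σ : Type*} (q : MvPolynomial σ ℂ) : MvPolynomial σ ℂ := map (starRingEnd ℂ) q

lemma eval_conjPoly {σ : Type*} (x : σ → ℂ) (q : MvPolynomial σ ℂ) :
    eval (fun j => starRingEnd ℂ (x j)) (conjPoly q) = starRingEnd ℂ (eval x q) := by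
  rw [conjPoly, eval_map, eval₂_comp]
  rfl

lemma eval_mix_rename_inl (z : Fin 2 → ℂ) (q : P2) :
    eval (mix z) (rename Sum.inl q) = eval z q := by
  rw [eval_rename]
  rfl

lemma eval_mix_rename_inr_conjPoly (z : Fin 2 → ℂ) (q : P2) :
    eval (mix z) (rename Sum.inr (conjPoly q)) = starRingEnd ℂ (eval z q) := by
  rw [eval_rename, ← eval_conjPoly]
  rfl

/-- A polynomial in `z, z̄` that vanishes on the totally real set of all `(z, conj z)` is zero. -/
lemma eq_zero_of_eval_mix (Q : P4) (h : ∀ z, eval (mix z) Q = 0) : Q = 0 := by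
  let u : Fin 2 ⊕ Fin 2 → P4 := Sum.elim
    (fun j => X (Sum.inl j) + C I * X (Sum.inr j)) (fun j => X (Sum.inl j) - C I * X (Sum.inr j))
  have hu (x) : eval x (bind₁ u Q) = eval (fun i => eval x (u i)) Q := by
    rw [← coe_aeval_eq_eval, RingHom.coe_coe, aeval_bind₁]
    rfl
  have hR : bind₁ u Q = 0 := by
    refine funext_set (fun _ => Set.range ((↑) : ℝ → ℂ))
      (fun _ => Set.infinite_range_of_injective ofReal_injective) fun x hx => ?_
    choose y hy using fun i => hx i (Set.mem_univ i)
    rw [hu, map_zero, ← h fun j => y (Sum.inl j) + I * y (Sum.inr j)]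
    congr 2
    funext i
    rcases i with j | j <;> simp [u, mix, ← hy, sub_eq_add_neg]
  refine MvPolynomial.funext fun x => ?_
  have hx := hu (Sum.elim (fun j => (x (Sum.inl j) + x (Sum.inr j)) / 2)
    (fun j => (x (Sum.inl j) - x (Sum.inr j)) / (2 * I)))
  rw [hR, map_zero] at hx
  rw [map_zero, hx]
  congr 2
  funext i
  rcases i with j | j <;> simp [u] <;> field_simp <;> ring

/-- The coefficients of a real-valued polynomial form a Hermitian array. -/
lemma conj_coeff_sumElim (P : P4) (hreal : ∀ z, (eval (mix z) P).im = 0) (a b : Fin 2 →₀ ℕ) :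
    starRingEnd ℂ (P.coeff (Finsupp.sumElim a b)) = P.coeff (Finsupp.sumElim b a) := by
  have hP : P - rename Sum.swap (conjPoly P) = 0 := eq_zero_of_eval_mix _ fun z => by
    have : mix z ∘ Sum.swap = fun i => starRingEnd ℂ (mix z i) := by
      funext i
      rcases i with j | j <;> simp [mix]
    rw [map_sub, eval_rename, this, eval_conjPoly, conj_eq_iff_im.2 (hreal z), sub_self]
  have h := congrArg (coeff (Finsupp.sumElim b a)) (sub_eq_zero.1 hP)
  rw [← Finsupp.mapDomain_swap_sumElim, coeff_rename_mapDomain _ Sum.swap_leftInverse.injective,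
    conjPoly, coeff_map, Finsupp.mapDomain_swap_sumElim] at h
  exact h.symm

/-- Functionals can be applied in the antiholomorphic variable of a vanishing sesquilinear sum. -/
lemma sum_conj_smul_eq_zero {ι : Type*} [Fintype ι] (p q : ι → P2) (φ : P2 →ₗ[ℂ] ℂ)
    (h : ∑ k, rename Sum.inl (p k) * rename Sum.inr (conjPoly (q k)) = (0 : P4)) :
    ∑ k, starRingEnd ℂ (φ (q k)) • p k = 0 := by
  refine MvPolynomial.funext fun z => ?_
  have hq : ∑ k, starRingEnd ℂ (eval z (p k)) • q k = 0 := by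
    refine MvPolynomial.funext fun w => ?_
    have := congrArg (fun Q => starRingEnd ℂ
      (eval (Sum.elim z fun j => starRingEnd ℂ (w j)) Q)) h
    simpa [eval_rename, Function.comp_def, eval_conjPoly, smul_eval] using this
  have := congrArg (fun q => starRingEnd ℂ (φ q)) hq
  simpa [smul_eval, mul_comm] using this

/-- A real-valued polynomial is a real diagonal combination of squared moduli of holomorphic
polynomials that possess a dual family of linear functionals. The vanishing squares are listed
as zero, so the length of the sum can be taken to be at least two. -/
lemma exists_diagonal_decomposition (P : P4) (hreal : ∀ z, (eval (mix z) P).im = 0) :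
    ∃ (N : ℕ) (d : Fin N → ℝ) (F : Fin N → P2) (φ : Fin N → P2 →ₗ[ℂ] ℂ), 2 ≤ N ∧
      P = ∑ k, C (d k : ℂ) * (rename Sum.inl (F k) * rename Sum.inr (conjPoly (F k))) ∧
      (∀ k, d k = 0 → F k = 0 ∧ φ k = 0) ∧
      (∀ k, d k ≠ 0 → ∀ l, φ k (F l) = if k = l then 1 else 0) := by
  classical
  let fst (m : Fin 2 ⊕ Fin 2 →₀ ℕ) := (Finsupp.sumFinsuppEquivProdFinsupp m).1
  let snd (m : Fin 2 ⊕ Fin 2 →₀ ℕ) := (Finsupp.sumFinsuppEquivProdFinsupp m).2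
  let E : Finset (Fin 2 →₀ ℕ) :=
    P.support.image fst ∪ P.support.image snd ∪ {0, Finsupp.single 0 1}
  have hE : 2 ≤ E.card := by
    have h : ({0, Finsupp.single 0 1} : Finset (Fin 2 →₀ ℕ)).card = 2 :=
      Finset.card_pair (by simp [eq_comm])
    exact h.symm.le.trans (Finset.card_le_card Finset.subset_union_right)
  let a (i : Fin E.card) : Fin 2 →₀ ℕ := E.equivFin.symm i
  have ha : Function.Injective a := Subtype.val_injective.comp E.equivFin.symm.injective
  have haE (m) (hm : m ∈ E) : ∃ i, a i = m := ⟨E.equivFin ⟨m, hm⟩, by simp [a]⟩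
  let H : Matrix (Fin E.card) (Fin E.card) ℂ :=
    Matrix.of fun i j => P.coeff (Finsupp.sumElim (a i) (a j))
  have hP : P = ∑ i, ∑ j, C (H i j) *
      (rename Sum.inl (monomial (a i) 1) * rename Sum.inr (monomial (a j) 1)) := by
    have hinj : Function.Injective
        fun x : Fin E.card × Fin E.card => Finsupp.sumElim (a x.1) (a x.2) := by
      rintro ⟨i, j⟩ ⟨k, l⟩ h
      have h₁ : a i = a k := Finsupp.ext fun t => DFunLike.congr_fun h (Sum.inl t)
      have h₂ : a j = a l := Finsupp.ext fun t => DFunLike.congr_fun h (Sum.inr t)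
      rw [ha h₁, ha h₂]
    have hsub : P.support ⊆ Finset.univ.image
        fun x : Fin E.card × Fin E.card => Finsupp.sumElim (a x.1) (a x.2) := by
      intro m hm
      obtain ⟨i, hi⟩ := haE (fst m) (Finset.mem_union_left _
        (Finset.mem_union_left _ (Finset.mem_image_of_mem fst hm)))
      obtain ⟨j, hj⟩ := haE (snd m) (Finset.mem_union_left _
        (Finset.mem_union_right _ (Finset.mem_image_of_mem snd hm)))
      refine Finset.mem_image.2 ⟨(i, j), Finset.mem_univ _, ?_⟩
      ext (t | t) <;> simp [hi, hj, fst, snd]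
    conv_lhs => rw [P.as_sum, Finset.sum_subset hsub fun m _ hm => by
      rw [notMem_support_iff.1 hm, monomial_zero], Finset.sum_image hinj.injOn,
      Fintype.sum_prod_type]
    simp [H, rename_monomial, monomial_mul, C_mul_monomial, Finsupp.sumElim_eq_add]
  have hH : H.IsHermitian := Matrix.IsHermitian.ext fun i j => conj_coeff_sumElim P hreal _ _
  let U : Matrix (Fin E.card) (Fin E.card) ℂ := hH.eigenvectorUnitary
  let d := hH.eigenvalues
  have hU : U.conjTranspose * U = 1 := Unitary.coe_star_mul_self hH.eigenvectorUnitary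
  have hUH (i j) : H i j = ∑ k, U i k * d k * starRingEnd ℂ (U j k) := by
    conv_lhs => rw [hH.spectral_theorem, Unitary.conjStarAlgAut_apply]
    simp [Matrix.mul_apply, Matrix.diagonal_apply, U, d, Matrix.star_apply]
  let G (k : Fin E.card) : P2 := ∑ i, C (U i k) * monomial (a i) 1
  have hG (i k) : coeff (a i) (G k) = U i k := by
    simp [G, coeff_sum, coeff_C_mul, coeff_monomial, ha.eq_iff]
  have hPG : P = ∑ k, C (d k : ℂ) * (rename Sum.inl (G k) * rename Sum.inr (conjPoly (G k))) := by
    conv_lhs => rw [hP]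
    simp_rw [hUH]
    simp only [map_sum, map_mul, G, conjPoly, map_C, rename_C, map_monomial, map_one,
      Finset.sum_mul, Finset.mul_sum]
    rw [Finset.sum_comm]
    rw [Finset.sum_congr rfl fun j _ => Finset.sum_comm]
    rw [Finset.sum_comm]
    exact Finset.sum_congr rfl fun k _ => Finset.sum_congr rfl fun i _ =>
      Finset.sum_congr rfl fun j _ => by ring
  let ψ (k : Fin E.card) : P2 →ₗ[ℂ] ℂ := ∑ i, starRingEnd ℂ (U i k) • lcoeff ℂ (a i)
  have hψ (k l) : ψ k (G l) = if k = l then 1 else 0 := by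
    have := congrFun (congrFun hU k) l
    rw [Matrix.mul_apply, Matrix.one_apply] at this
    simpa [ψ, hG] using this
  refine ⟨E.card, d, fun k => if d k = 0 then 0 else G k, fun k => if d k = 0 then 0 else ψ k,
    hE, ?_, ?_, ?_⟩
  · conv_lhs => rw [hPG]
    refine Finset.sum_congr rfl fun k _ => ?_
    by_cases hk : d k = 0 <;> simp [hk]
  · intro k hk
    simp [hk]
  · intro k hk l
    by_cases hl : d l = 0
    · have : k ≠ l := fun h => hk (h ▸ hl)
      simp [hl, this]
    · simp [hk, hl, hψ]

/-- The action of a holomorphic vector field on a sesquilinear sum. -/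
lemma tangential_derivative_sum {ι : Type*} [Fintype ι] (f : Fin 2 → P2) (d : ι → ℝ)
    (F : ι → P2) (P : P4)
    (hP : P = ∑ k, C (d k : ℂ) * (rename Sum.inl (F k) * rename Sum.inr (conjPoly (F k)))) :
    rename Sum.inl (f 0) * pderiv (Sum.inl 0) P + rename Sum.inl (f 1) * pderiv (Sum.inl 1) P =
      ∑ k, C (d k : ℂ) * (rename Sum.inl (vf f (F k)) * rename Sum.inr (conjPoly (F k))) := by
  classical
  have h (j : Fin 2) : pderiv (Sum.inl j) P = ∑ k, C (d k : ℂ) *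
      (rename Sum.inl (pderiv j (F k)) * rename Sum.inr (conjPoly (F k))) := by
    have h₀ (q : P2) : pderiv (Sum.inl j) (rename Sum.inr q : P4) = 0 := by
      refine pderiv_eq_zero_of_notMem_vars fun hj => ?_
      simpa using vars_rename _ _ hj
    conv_lhs => rw [hP]
    simp [pderiv_rename Sum.inl_injective, h₀, Derivation.leibniz, mul_comm]
  rw [h, h, Finset.mul_sum, Finset.mul_sum, ← Finset.sum_add_distrib]
  refine Finset.sum_congr rfl fun k _ => ?_
  simp only [vf, map_add, map_mul]
  ring

/-- The matrix of a vector field, skew with respect to a real diagonal form, in a family of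
polynomials with dual functionals. -/
lemma vf_eq_sum_and_skew {N : ℕ} (f : Fin 2 → P2) (d : Fin N → ℝ) (F : Fin N → P2)
    (φ : Fin N → P2 →ₗ[ℂ] ℂ) (h0 : ∀ k, d k = 0 → F k = 0 ∧ φ k = 0)
    (hφ : ∀ k, d k ≠ 0 → ∀ l, φ k (F l) = if k = l then 1 else 0)
    (hskew : ∑ k, C (d k : ℂ) * (rename Sum.inl (vf f (F k)) * rename Sum.inr (conjPoly (F k)) +
      rename Sum.inl (F k) * rename Sum.inr (conjPoly (vf f (F k)))) = (0 : P4)) :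
    (∀ l, vf f (F l) = ∑ k, C (φ k (vf f (F l))) * F k) ∧
      ∀ k l, d l * φ k (vf f (F l)) = -(d k * starRingEnd ℂ (φ l (vf f (F k)))) := by
  have key (l : Fin N) (hl : d l ≠ 0) : C (d l : ℂ) * vf f (F l) =
      -∑ k, C (d k * starRingEnd ℂ (φ l (vf f (F k)))) * F k := by
    have := sum_conj_smul_eq_zero (ι := Fin N ⊕ Fin N)
      (Sum.elim (fun k => C (d k : ℂ) * vf f (F k)) fun k => C (d k : ℂ) * F k)
      (Sum.elim F fun k => vf f (F k)) (φ l) (by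
        rw [← hskew]
        simp [mul_add, Finset.sum_add_distrib, mul_assoc])
    simp only [Fintype.sum_sum_type, Sum.elim_inl, Sum.elim_inr, hφ l hl, apply_ite, map_one,
      map_zero, ite_smul, one_smul, zero_smul, Finset.sum_ite_eq, Finset.mem_univ, if_true] at this
    rw [eq_neg_iff_add_eq_zero, ← this]
    refine congrArg _ (Finset.sum_congr rfl fun k _ => ?_)
    rw [C_mul, smul_eq_C_mul]
    ring
  have skew (k l : Fin N) :
      d l * φ k (vf f (F l)) = -(d k * starRingEnd ℂ (φ l (vf f (F k)))) := by
    by_cases hl : d l = 0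
    · simp [hl, (h0 l hl).2]
    by_cases hk : d k = 0
    · simp [hk, (h0 k hk).2]
    have := congrArg (φ k) (key l hl)
    simpa only [C_mul', map_smul, map_neg, map_sum, hφ k hk, smul_eq_mul, mul_ite, mul_one,
      mul_zero, Finset.sum_ite_eq, Finset.mem_univ, if_true] using this
  refine ⟨fun l => ?_, skew⟩
  by_cases hl : d l = 0
  · simp [(h0 l hl).1, vf]
  refine mul_left_cancel₀ (a := C (d l : ℂ)) (by simpa using hl) ?_
  rw [key l hl, Finset.mul_sum, ← Finset.sum_neg_distrib]
  refine Finset.sum_congr rfl fun k _ => ?_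
  rw [← mul_assoc, ← C_mul, skew, C_neg, neg_mul]

/-- a generalized rotation `Y` of a holomorphically nondegenerate
model hypersurface `M_P` is `f`-related, via a polynomial map
`f(z,w) = (F₁(z),…,F_N(z),w)` sending `M_P` into a hyperquadric
`H = {Im η = Σ a_{lm} ζ_l conj ζ_m}`, to a linear infinitesimal CR automorphism
`Z = Σ (Cζ)_l ∂/∂ζ_l` of `H`. -/
theorem stmt6 (μ : Fin 2 → ℚ) (hμ0 : 0 < μ 1) (hμ12 : μ 1 ≤ μ 0) (hμ1 : μ 0 ≤ 1 / 2)
    (P : P4)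
    (hreal : ∀ z : Fin 2 → ℂ, (eval (mix z) P).im = 0)
    (hPhom : IsWeightedHomogeneous (Sum.elim μ μ) P 1)
    (hplh : ∀ m ∈ P.support, (∃ i, m (Sum.inl i) ≠ 0) ∧ (∃ i, m (Sum.inr i) ≠ 0))
    -- `M_P` is holomorphically nondegenerate:
    (hnd : ∀ g : Fin 2 → P2,
      rename Sum.inl (g 0) * pderiv (Sum.inl 0) P +
        rename Sum.inl (g 1) * pderiv (Sum.inl 1) P = 0 → g = 0)
    -- `Y = f₁ ∂/∂z₁ + f₂ ∂/∂z₂` is a generalized rotation of `M_P`: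
    (f : Fin 2 → P2) (hf : f ≠ 0) (δ : ℚ) (hδ : 0 < δ)
    (hfhom : ∀ j, IsWeightedHomogeneous μ (f j) (μ j + δ))
    (htan : ∀ z : Fin 2 → ℂ,
      (eval z (f 0) * eval (mix z) (pderiv (Sum.inl 0) P) +
       eval z (f 1) * eval (mix z) (pderiv (Sum.inl 1) P)).re = 0) :
    ∃ (N : ℕ) (A Cm : Matrix (Fin N) (Fin N) ℂ) (F : Fin N → P2),
      2 ≤ N ∧
      A.IsHermitian ∧
      -- (i) `P(z,z̄) = Σ_{l,m} a_{lm} F_l(z) conj (F_m(z))`, so `f` maps `M_P` into `H`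
      (∀ z : Fin 2 → ℂ,
        eval (mix z) P =
          ∑ l, ∑ m, A l m * eval z (F l) * (starRingEnd ℂ) (eval z (F m))) ∧
      -- (ii) `Z = Σ_l (Cζ)_l ∂/∂ζ_l` is an infinitesimal CR automorphism of `H`
      (∀ ζ : Fin N → ℂ,
        (∑ l, ∑ m, A l m * (∑ i, Cm l i * ζ i) * (starRingEnd ℂ) (ζ m)).re = 0) ∧
      -- (iii) `Y` is `f`-related to `Z`
      (∀ l, vf f (F l) = ∑ m, C (Cm l m) * F m) := by
  obtain ⟨N, d, F, φ, hN, hP, h0, hφ⟩ := exists_diagonal_decomposition P hreal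
  obtain ⟨hvf, hskew⟩ := vf_eq_sum_and_skew f d F φ h0 hφ <| eq_zero_of_eval_mix _ fun z => by
    have h := congrArg (eval (mix z)) (tangential_derivative_sum f d F P hP)
    simp only [map_add, map_mul, map_sum, eval_C, eval_mix_rename_inl,
      eval_mix_rename_inr_conjPoly] at h ⊢
    have hz := htan z
    rw [h] at hz
    simp only [mul_add, Finset.sum_add_distrib]
    rw [← (by rw [add_conj, hz]; simp : _ + starRingEnd ℂ _ = 0)]
    simp [mul_comm]
  refine ⟨N, Matrix.diagonal fun k => (d k : ℂ), Matrix.of fun l k => φ k (vf f (F l)), F, hN,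
    ?_, fun z => ?_, fun ζ => ?_, hvf⟩
  · simp [Matrix.IsHermitian, Matrix.diagonal_conjTranspose, Pi.star_def]
  · conv_lhs => rw [hP]
    simp [Matrix.diagonal_apply, eval_mix_rename_inl, eval_mix_rename_inr_conjPoly, mul_assoc]
  · simp only [Matrix.diagonal_apply, ite_mul, zero_mul, Finset.sum_ite_eq, Finset.mem_univ,
      if_true, Matrix.of_apply]
    rw [← self_eq_neg, ← neg_re, ← conj_re]
    congr 1
    simp only [map_sum, map_mul, conj_ofReal, conj_conj, Finset.mul_sum, Finset.sum_mul,
      ← Finset.sum_neg_distrib]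
    rw [Finset.sum_comm]
    refine Finset.sum_congr rfl fun l _ => Finset.sum_congr rfl fun k _ => ?_
    linear_combination (ζ k * starRingEnd ℂ (ζ l)) * hskew k l
end
end

section
/- Let M_P be a model hypersurface, Y = f₁∂/∂z₁ + f₂∂/∂z₂ a generalized rotation of M_P, and P = Σ_{k=1}^{l} P_k the bihomogeneous expansion of P, where c₁ < … < c_l are the distinct weighted degrees in the z-variables occurring in P and P_k collects the monomials of P whose z-part has weighted degree c_k. Then for each k = 1,…,l there exist an integer d_k with 1 ≤ d_k ≤ k, holomorphic polynomials Q_k and Q'_k, weighted homogeneous of weighted degrees c_k and 1−c_k respectively, and a polynomial P̃_k in z,z̄ of the same bidegree as P_k, such that P_k(z,z̄) = Q_k(z)·conj(Q'_k(z)) + P̃_k(z,z̄), Y^{d_k}(Q'_k) = 0, Y^{d_k−1}(Q'_k) ≠ 0, and Ȳ^{d_k−1}(P̃_k) = 0, where Ȳ = conj(f₁)(z̄) ∂/∂z̄₁ + conj(f₂)(z̄) ∂/∂z̄₂ differentiates only the antiholomorphic variables (its coefficients being the conjugate polynomials of f₁, f₂ in the variables z̄). -/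
open MvPolynomial Complex

noncomputable section

/-- Action of the conjugate vector field
`Ȳ = conj(f₁)(z̄) ∂/∂z̄₁ + conj(f₂)(z̄) ∂/∂z̄₂` on polynomials in `z, z̄`:
its coefficients are the conjugate polynomials of `f₁, f₂` in the variables `z̄`,
and it differentiates only the antiholomorphic variables. -/
def vfBar (f : Fin 2 → P2) (R : P4) : P4 :=
  rename Sum.inr (map (starRingEnd ℂ) (f 0)) * pderiv (Sum.inr 0) R +
  rename Sum.inr (map (starRingEnd ℂ) (f 1)) * pderiv (Sum.inr 1) R

/-- Weighted degree of the holomorphic (`z`-) part of a monomial exponent. -/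
def holDeg (μ : Fin 2 → ℚ) (m : (Fin 2 ⊕ Fin 2) →₀ ℕ) : ℚ :=
  (m (Sum.inl 0) : ℚ) * μ 0 + (m (Sum.inl 1) : ℚ) * μ 1

/-- Weighted degree of the antiholomorphic (`z̄`-) part of a monomial exponent. -/
def aholDeg (μ : Fin 2 → ℚ) (m : (Fin 2 ⊕ Fin 2) →₀ ℕ) : ℚ :=
  (m (Sum.inr 0) : ℚ) * μ 0 + (m (Sum.inr 1) : ℚ) * μ 1

lemma eval_bind₁_apply {σ τ : Type*} (x : τ → ℂ) (φ : σ → MvPolynomial τ ℂ)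
    (R : MvPolynomial σ ℂ) : eval x (bind₁ φ R) = eval (fun i => eval x (φ i)) R :=
  eval₂Hom_bind₁ (RingHom.id ℂ) x φ R

/-- A polynomial in `z, z̄` that vanishes at all points `(z, z̄)` is zero. -/
lemma eq_zero_of_forall_eval_mix {R : P4} (h : ∀ z, eval (mix z) R = 0) : R = 0 := by
  set φ : Fin 2 ⊕ Fin 2 → P4 :=
    Sum.elim (fun j => X (Sum.inl j) + C I * X (Sum.inr j))
      (fun j => X (Sum.inl j) - C I * X (Sum.inr j)) with hφ
  have key : bind₁ φ R = 0 := by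
    refine MvPolynomial.funext_set (fun _ => Set.range ((↑) : ℝ → ℂ))
      (fun _ => Set.infinite_range_of_injective ofReal_injective) fun x hx => ?_
    choose y hy using fun i => hx i trivial
    rw [map_zero, ← h (fun j => x (Sum.inl j) + I * x (Sum.inr j)), eval_bind₁_apply]
    congr 2
    funext i
    rcases i with j | j
    · simp [hφ, mix]
    · simp [hφ, mix, ← hy, sub_eq_add_neg]
  refine MvPolynomial.funext fun w => ?_
  have := congrArg (eval (Sum.elim (fun j => (w (Sum.inl j) + w (Sum.inr j)) / 2)
    (fun j => (w (Sum.inl j) - w (Sum.inr j)) / (2 * I)))) key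
  rw [eval_bind₁_apply, map_zero] at this
  rw [map_zero, ← this]
  congr 2
  funext i
  rcases i with j | j <;> simp [hφ] <;> field_simp <;> ring

/-- `vf f` as a derivation. -/
def vfDer (f : Fin 2 → P2) : Derivation ℂ P2 P2 :=
  f 0 • pderiv 0 + f 1 • pderiv 1

lemma coe_vfDer (f : Fin 2 → P2) : ⇑(vfDer f) = vf f := by
  funext q
  simp [vfDer, vf]

/-- `vfBar f` as a derivation. -/
def vfBarDer (f : Fin 2 → P2) : Derivation ℂ P4 P4 :=
  (rename Sum.inr (map (starRingEnd ℂ) (f 0)) : P4) • pderiv (Sum.inr 0) +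
  (rename Sum.inr (map (starRingEnd ℂ) (f 1)) : P4) • pderiv (Sum.inr 1)

lemma coe_vfBarDer (f : Fin 2 → P2) : ⇑(vfBarDer f) = vfBar f := by
  funext q
  simp [vfBarDer, vfBar]

/-- The action of `Y` on the holomorphic variables of polynomials in `z, z̄`. -/
def vfHolDer (f : Fin 2 → P2) : Derivation ℂ P4 P4 :=
  (rename Sum.inl (f 0) : P4) • pderiv (Sum.inl 0) +
  (rename Sum.inl (f 1) : P4) • pderiv (Sum.inl 1)

lemma vfHolDer_apply (f : Fin 2 → P2) (R : P4) :
    vfHolDer f R = rename Sum.inl (f 0) * pderiv (Sum.inl 0) R +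
      rename Sum.inl (f 1) * pderiv (Sum.inl 1) R := by
  simp [vfHolDer]

lemma pderiv_inl_rename_inr (i : Fin 2) (q : P2) :
    pderiv (Sum.inl i) (rename Sum.inr q : P4) = 0 := by
  induction q using MvPolynomial.induction_on with
  | C a => simp
  | add p q hp hq => simp [hp, hq]
  | mul_X p j hp => simp [hp]

lemma pderiv_inr_rename_inl (i : Fin 2) (q : P2) :
    pderiv (Sum.inr i) (rename Sum.inl q : P4) = 0 := by
  induction q using MvPolynomial.induction_on with
  | C a => simp
  | add p q hp hq => simp [hp, hq]
  | mul_X p j hp => simp [hp]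

lemma vfHolDer_vfBarDer_comm (f : Fin 2 → P2) (R : P4) :
    vfHolDer f (vfBarDer f R) = vfBarDer f (vfHolDer f R) := by
  have : ⁅vfHolDer f, vfBarDer f⁆ = 0 := by
    refine MvPolynomial.derivation_ext fun i => ?_
    rw [Derivation.commutator_apply]
    rcases i with j | j <;> fin_cases j <;>
      simp [vfHolDer, vfBarDer, pderiv_inl_rename_inr, pderiv_inr_rename_inl, pderiv_X]
  have h := congrArg (fun D => D R) this
  simpa [Derivation.commutator_apply, sub_eq_zero] using h

/-- The conjugate polynomial, in which `z` and `z̄` are exchanged. -/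
def conjSwap : P4 →+* P4 :=
  (rename Sum.swap : P4 →ₐ[ℂ] P4).toRingHom.comp (map (starRingEnd ℂ))

lemma eval_mix_conjSwap (z : Fin 2 → ℂ) (R : P4) :
    eval (mix z) (conjSwap R) = (starRingEnd ℂ) (eval (mix z) R) := by
  have : (eval (mix z)).comp conjSwap = (starRingEnd ℂ).comp (eval (mix z)) := by
    ext i
    · simp [conjSwap]
    · rcases i with j | j <;> simp [conjSwap, mix]
  exact congrArg (fun φ : P4 →+* ℂ => φ R) this

lemma eval_mix_rename_inr (z : Fin 2 → ℂ) (q : P2) :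
    eval (mix z) (rename Sum.inr (map (starRingEnd ℂ) q)) = (starRingEnd ℂ) (eval z q) := by
  rw [eval_rename, eval_map]
  exact (eval₂_comp_left (starRingEnd ℂ) (RingHom.id ℂ) z q).symm

lemma pderiv_inr_conjSwap (i : Fin 2) (R : P4) :
    pderiv (Sum.inr i) (conjSwap R) = conjSwap (pderiv (Sum.inl i) R) := by
  have := pderiv_rename (R := ℂ) (f := (Sum.swap : Fin 2 ⊕ Fin 2 → Fin 2 ⊕ Fin 2))
    Sum.swap_leftInverse.injective (Sum.inl i) (map (starRingEnd ℂ) R)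
  simpa [conjSwap, pderiv_map] using this

/-- The tangency condition of a generalized rotation as a polynomial identity. -/
lemma vfHolDer_add_vfBarDer_eq_zero {P : P4} (hreal : ∀ z, (eval (mix z) P).im = 0)
    {f : Fin 2 → P2}
    (htan : ∀ z : Fin 2 → ℂ,
      (eval z (f 0) * eval (mix z) (pderiv (Sum.inl 0) P) +
       eval z (f 1) * eval (mix z) (pderiv (Sum.inl 1) P)).re = 0) :
    vfHolDer f P + vfBarDer f P = 0 := by
  have hP : conjSwap P = P := by
    rw [← sub_eq_zero]
    refine eq_zero_of_forall_eval_mix fun z => ?_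
    rw [map_sub, eval_mix_conjSwap, conj_eq_iff_im.2 (hreal z), sub_self]
  refine eq_zero_of_forall_eval_mix fun z => ?_
  have hbar : eval (mix z) (vfBarDer f P) = (starRingEnd ℂ) (eval (mix z) (vfHolDer f P)) := by
    rw [coe_vfBarDer, vfBar, ← hP, pderiv_inr_conjSwap, pderiv_inr_conjSwap, hP, vfHolDer_apply]
    simp only [map_add, map_mul, eval_mix_rename_inl, eval_mix_rename_inr, eval_mix_conjSwap]
  rw [map_add, hbar, add_conj, vfHolDer_apply]
  simp only [map_add, map_mul, eval_mix_rename_inl]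
  rw [htan z]
  simp

section Weights

variable {σ τ : Type*} {w : σ → ℚ}

lemma MvPolynomial.IsWeightedHomogeneous.rename' {f : σ → τ} {v : τ → ℚ} {q : MvPolynomial σ ℂ}
    {n : ℚ} (hq : IsWeightedHomogeneous (v ∘ f) q n) :
    IsWeightedHomogeneous v (rename f q) n := by
  classical
  rw [q.as_sum, map_sum]
  refine IsWeightedHomogeneous.sum _ _ _ fun m hm => ?_
  rw [rename_monomial]
  refine isWeightedHomogeneous_monomial _ _ _ ?_
  rw [← hq (mem_support_iff.1 hm), Finsupp.weight_apply, Finsupp.weight_apply,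
    Finsupp.sum_mapDomain_index (by simp) (by intros; simp [add_mul])]
  rfl

lemma MvPolynomial.IsWeightedHomogeneous.map_conj {q : MvPolynomial σ ℂ} {n : ℚ}
    (hq : IsWeightedHomogeneous w q n) :
    IsWeightedHomogeneous w (map (starRingEnd ℂ) q) n := by
  intro m hm
  refine hq fun h => hm ?_
  rw [coeff_map, h, map_zero]

lemma weightedHomogeneousComponent_comm (T : MvPolynomial σ ℂ →ₗ[ℂ] MvPolynomial σ ℂ) (e : ℚ)
    (hT : ∀ n q, IsWeightedHomogeneous w q n → IsWeightedHomogeneous w (T q) (n + e)) (n : ℚ)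
    (R : MvPolynomial σ ℂ) :
    weightedHomogeneousComponent w (n + e) (T R) = T (weightedHomogeneousComponent w n R) := by
  induction R using MvPolynomial.induction_on' with
  | add p q hp hq => simp [hp, hq]
  | monomial m r =>
    have h := isWeightedHomogeneous_monomial w m r rfl
    rw [weightedHomogeneousComponent_of_mem h, weightedHomogeneousComponent_of_mem (hT _ _ h)]
    split_ifs with h1 h2 h2
    · rfl
    · exact absurd (add_right_cancel h1) h2
    · exact absurd (by rw [h2]) h1
    · simp

lemma sum_weight_mul_X_mul_pderiv [Fintype σ] {q : MvPolynomial σ ℂ} {e : ℚ}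
    (hq : IsWeightedHomogeneous w q e) :
    ∑ i, C (w i : ℂ) * (X i * pderiv i q) = C (e : ℂ) * q := by
  have hX : ∀ (i : σ) (m : σ →₀ ℕ), coeff m (X i * pderiv i q) = m i * coeff m q := by
    intro i m
    classical
    rw [coeff_X_mul']
    split_ifs with h
    · rw [coeff_pderiv]
      have h1 : Finsupp.single i 1 ≤ m := by
        simpa [Nat.one_le_iff_ne_zero] using h
      rw [tsub_add_cancel_of_le h1, mul_comm]
      congr 1
      have : 1 ≤ m i := by simpa using h1
      simp [Finsupp.tsub_apply, this]
    · simp [Finsupp.notMem_support_iff.1 h]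
  ext m
  simp only [coeff_sum, coeff_C_mul, hX]
  by_cases hm : coeff m q = 0
  · simp [hm]
  · rw [← hq hm, Finsupp.weight_apply, Finsupp.sum_fintype _ _ (by simp)]
    push_cast
    rw [Finset.sum_mul]
    refine Finset.sum_congr rfl fun i _ => ?_
    simp
    ring

end Weights

section Kernel

/-- The restriction of polynomials to the line `t ↦ p + t v`. -/
def lineRestrict (p v : Fin 2 → ℂ) : P2 →ₐ[ℂ] Polynomial ℂ :=
  aeval fun i => Polynomial.C (p i) + Polynomial.C (v i) * Polynomial.X

lemma eval_lineRestrict (p v : Fin 2 → ℂ) (t : ℂ) (q : P2) :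
    (lineRestrict p v q).eval t = eval (fun i => p i + v i * t) q := by
  induction q using MvPolynomial.induction_on with
  | C a => simp [lineRestrict]
  | add p q hp hq => simp [hp, hq]
  | mul_X q j hq => rw [map_mul, Polynomial.eval_mul, hq]; simp [lineRestrict]

lemma derivative_lineRestrict (p v : Fin 2 → ℂ) (q : P2) :
    Polynomial.derivative (lineRestrict p v q) =
      ∑ i, Polynomial.C (v i) * lineRestrict p v (pderiv i q) := by
  induction q using MvPolynomial.induction_on with
  | C a => simp [lineRestrict]
  | add p q hp hq => simp [hp, hq, mul_add]; ring
  | mul_X q j hq =>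
    have hX : ∀ j, lineRestrict p v (X j) =
      Polynomial.C (p j) + Polynomial.C (v j) * Polynomial.X := by simp [lineRestrict]
    rw [map_mul, Polynomial.derivative_mul, hq]
    fin_cases j <;> simp [hX, pderiv_X] <;> ring

lemma Polynomial.eq_zero_of_wronskian_eq_zero {G H : Polynomial ℂ} {t : ℂ} (hG : G.eval t ≠ 0)
    (hH : H.eval t = 0) (h : G * derivative H = H * derivative G) : H = 0 := by
  by_contra hH0
  have hG0 : G ≠ 0 := by rintro rfl; simp at hG
  have hH' : derivative H ≠ 0 := by
    intro h0
    rw [Polynomial.eq_C_of_derivative_eq_zero h0] at hH hH0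
    simp only [eval_C] at hH
    simp [hH] at hH0
  have hne : H * derivative G ≠ 0 := h ▸ mul_ne_zero hG0 hH'
  have h1 := congrArg (rootMultiplicity t) h
  rw [rootMultiplicity_mul hne, rootMultiplicity_mul (mul_ne_zero hG0 hH'),
    rootMultiplicity_eq_zero hG, derivative_rootMultiplicity_of_root hH] at h1
  have h2 : 0 < rootMultiplicity t H := (rootMultiplicity_pos hH0).2 hH
  lia

lemma exists_eq_smul_of_mul_pderiv_eq {g h : P2} (hg : g ≠ 0)
    (hgh : ∀ i, g * pderiv i h = h * pderiv i g) : ∃ r : ℂ, h = r • g := by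
  obtain ⟨p, hp⟩ : ∃ p, eval p g ≠ 0 := by
    by_contra! hall
    exact hg (MvPolynomial.funext fun x => by rw [hall x, map_zero])
  refine ⟨eval p h / eval p g, ?_⟩
  set r := eval p h / eval p g with hr
  rw [← sub_eq_zero]
  have hgk : ∀ i, g * pderiv i (h - r • g) = (h - r • g) * pderiv i g := by
    intro i
    rw [map_sub, Derivation.map_smul, mul_sub, hgh i, sub_mul, mul_smul_comm, smul_mul_assoc]
  have hk : eval p (h - r • g) = 0 := by
    rw [map_sub, smul_eval, hr, div_mul_cancel₀ _ hp, sub_self]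
  generalize h - r • g = k at hgk hk
  refine MvPolynomial.funext fun x => ?_
  have hline : lineRestrict p (x - p) k = 0 := by
    refine Polynomial.eq_zero_of_wronskian_eq_zero (G := lineRestrict p (x - p) g) (t := 0)
      ?_ ?_ ?_
    · simpa [eval_lineRestrict] using hp
    · simpa [eval_lineRestrict] using hk
    · rw [derivative_lineRestrict, derivative_lineRestrict, Finset.mul_sum, Finset.mul_sum]
      refine Finset.sum_congr rfl fun i _ => ?_
      rw [mul_left_comm, ← map_mul, hgk, map_mul, mul_left_comm]
  have := eval_lineRestrict p (x - p) 1 k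
  rw [hline] at this
  simpa using this.symm

/-- Each weighted homogeneous piece of nonzero degree of the kernel of a nonzero vector field is at
most one-dimensional. -/
lemma exists_eq_smul_of_vf_eq_zero {μ : Fin 2 → ℚ} {f : Fin 2 → P2} (hf : f ≠ 0) {e : ℚ}
    (he : e ≠ 0) {g h : P2} (hg : g ≠ 0) (hge : IsWeightedHomogeneous μ g e)
    (hhe : IsWeightedHomogeneous μ h e) (hfg : vf f g = 0) (hfh : vf f h = 0) :
    ∃ r : ℂ, h = r • g := by
  have Eg := sum_weight_mul_X_mul_pderiv hge
  have Eh := sum_weight_mul_X_mul_pderiv hhe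
  rw [Fin.sum_univ_two] at Eg Eh
  rw [vf] at hfg hfh
  have hjac : pderiv 0 g * pderiv 1 h = pderiv 1 g * pderiv 0 h := by
    obtain ⟨i, hi⟩ := Function.ne_iff.1 hf
    refine mul_left_cancel₀ hi ?_
    fin_cases i
    · simp only [Fin.zero_eta]
      linear_combination pderiv 1 h * hfg - pderiv 1 g * hfh
    · simp only [Fin.mk_one]
      linear_combination pderiv 0 g * hfh - pderiv 0 h * hfg
  have hC : (C (e : ℂ) : P2) ≠ 0 := by simpa using he
  refine exists_eq_smul_of_mul_pderiv_eq hg fun i => mul_left_cancel₀ hC ?_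
  fin_cases i
  · simp only [Fin.zero_eta]
    linear_combination pderiv 0 g * Eh - pderiv 0 h * Eg - C (μ 1 : ℂ) * X 1 * hjac
  · simp only [Fin.mk_one]
    linear_combination pderiv 1 g * Eh - pderiv 1 h * Eg + C (μ 0 : ℂ) * X 0 * hjac

end Kernel

section Slices

lemma coeff_coeff_sumAlgEquiv (a b : Fin 2 →₀ ℕ) (R : P4) :
    coeff b (coeff a (sumAlgEquiv ℂ (Fin 2) (Fin 2) R)) =
      coeff (Finsupp.sumFinsuppAddEquivProdFinsupp.symm (a, b)) R := by
  simp [sumAlgEquiv, coeff, AddMonoidAlgebra.curryAlgEquiv, AddMonoidAlgebra.curryRingEquiv,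
    AddMonoidAlgebra.curryAddEquiv]

lemma sumAlgEquiv_rename_inr (q : P2) :
    sumAlgEquiv ℂ (Fin 2) (Fin 2) (rename Sum.inr q) = C q :=
  congrArg (fun φ : P2 →ₐ[ℂ] _ => φ q) (sumAlgEquiv_comp_rename_inr ℂ (Fin 2) (Fin 2))

lemma sumAlgEquiv_rename_inl (q : P2) :
    sumAlgEquiv ℂ (Fin 2) (Fin 2) (rename Sum.inl q) = map C q :=
  congrArg (fun φ : P2 →ₐ[ℂ] _ => φ q) (sumAlgEquiv_comp_rename_inl ℂ (Fin 2) (Fin 2))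

lemma coeff_sumAlgEquiv_pderiv_inr (a : Fin 2 →₀ ℕ) (i : Fin 2) (R : P4) :
    coeff a (sumAlgEquiv ℂ (Fin 2) (Fin 2) (pderiv (Sum.inr i) R)) =
      pderiv i (coeff a (sumAlgEquiv ℂ (Fin 2) (Fin 2) R)) := by
  classical
  induction R using MvPolynomial.induction_on generalizing a with
  | C r => simp [coeff_C, apply_ite]
  | add p q hp hq => simp only [map_add, coeff_add, hp, hq]
  | mul_X p j hp =>
    rcases j with j | j
    · rw [Derivation.leibniz, pderiv_X_of_ne (by simp), smul_zero, zero_add, smul_eq_mul,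
        map_mul, map_mul, sumAlgEquiv_X_inl, mul_comm (X j), coeff_mul_X', coeff_mul_X', hp,
        apply_ite (pderiv i), map_zero]
    · have hs : sumAlgEquiv ℂ (Fin 2) (Fin 2) (pderiv (Sum.inr i) (X (Sum.inr j))) =
          C (pderiv i (X j)) := by
        by_cases hij : j = i
        · subst hij; simp
        · simp [pderiv_X, hij]
      rw [Derivation.leibniz, map_add, smul_eq_mul, smul_eq_mul, map_mul, map_mul, map_mul, hs,
        sumAlgEquiv_X_inr, coeff_add, mul_comm _ (C (pderiv i (X j))), mul_comm _ (C (X j)),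
        coeff_C_mul, coeff_C_mul, coeff_C_mul, hp, Derivation.leibniz, smul_eq_mul, smul_eq_mul]
      ring

/-- `Ȳ` acts coefficientwise on a polynomial expanded in powers of `z`. -/
lemma coeff_sumAlgEquiv_vfBar (f : Fin 2 → P2) (a : Fin 2 →₀ ℕ) (R : P4) :
    coeff a (sumAlgEquiv ℂ (Fin 2) (Fin 2) (vfBar f R)) =
      vf (fun i => map (starRingEnd ℂ) (f i)) (coeff a (sumAlgEquiv ℂ (Fin 2) (Fin 2) R)) := by
  simp only [vfBar, vf, map_add, map_mul, sumAlgEquiv_rename_inr, coeff_add, coeff_C_mul,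
    coeff_sumAlgEquiv_pderiv_inr]

lemma coeff_sumAlgEquiv_iterate_vfBar (f : Fin 2 → P2) (n : ℕ) (a : Fin 2 →₀ ℕ) (R : P4) :
    coeff a (sumAlgEquiv ℂ (Fin 2) (Fin 2) ((vfBar f)^[n] R)) =
      (vf fun i => map (starRingEnd ℂ) (f i))^[n]
        (coeff a (sumAlgEquiv ℂ (Fin 2) (Fin 2) R)) := by
  induction n with
  | zero => rfl
  | succ n ih => rw [Function.iterate_succ_apply', coeff_sumAlgEquiv_vfBar, ih,
      Function.iterate_succ_apply']

lemma map_conj_map_conj (q : P2) : map (starRingEnd ℂ) (map (starRingEnd ℂ) q) = q :=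
  MvPolynomial.ext _ _ fun m => by rw [coeff_map, coeff_map, conj_conj]

lemma iterate_vf_map_conj (f : Fin 2 → P2) (n : ℕ) (q : P2) :
    (vf f)^[n] (map (starRingEnd ℂ) q) =
      map (starRingEnd ℂ) ((vf fun i => map (starRingEnd ℂ) (f i))^[n] q) := by
  induction n with
  | zero => rfl
  | succ n ih =>
    rw [Function.iterate_succ_apply', Function.iterate_succ_apply', ih]
    simp only [vf, map_add, map_mul, map_conj_map_conj, pderiv_map]

end Slices

section Bidegree

lemma weight_elim_zero (μ : Fin 2 → ℚ) (m : Fin 2 ⊕ Fin 2 →₀ ℕ) :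
    Finsupp.weight (Sum.elim μ 0) m = holDeg μ m := by
  rw [Finsupp.weight_apply, Finsupp.sum_fintype _ _ (by simp), holDeg]
  simp

lemma weight_zero_elim (μ : Fin 2 → ℚ) (m : Fin 2 ⊕ Fin 2 →₀ ℕ) :
    Finsupp.weight (Sum.elim 0 μ) m = aholDeg μ m := by
  rw [Finsupp.weight_apply, Finsupp.sum_fintype _ _ (by simp), aholDeg]
  simp

lemma weight_elim_elim (μ : Fin 2 → ℚ) (m : Fin 2 ⊕ Fin 2 →₀ ℕ) :
    Finsupp.weight (Sum.elim μ μ) m = holDeg μ m + aholDeg μ m := by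
  rw [Finsupp.weight_apply, Finsupp.sum_fintype _ _ (by simp), aholDeg, holDeg]
  simp

lemma holDeg_sumElim (μ : Fin 2 → ℚ) (a b : Fin 2 →₀ ℕ) :
    holDeg μ (Finsupp.sumFinsuppAddEquivProdFinsupp.symm (a, b)) = Finsupp.weight μ a := by
  rw [Finsupp.weight_apply, Finsupp.sum_fintype _ _ (by simp), holDeg]
  simp

lemma aholDeg_sumElim (μ : Fin 2 → ℚ) (a b : Fin 2 →₀ ℕ) :
    aholDeg μ (Finsupp.sumFinsuppAddEquivProdFinsupp.symm (a, b)) = Finsupp.weight μ b := by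
  rw [Finsupp.weight_apply, Finsupp.sum_fintype _ _ (by simp), aholDeg]
  simp

lemma isWeightedHomogeneous_vf {μ : Fin 2 → ℚ} {f : Fin 2 → P2} {δ n : ℚ}
    (hf : ∀ j, IsWeightedHomogeneous μ (f j) (μ j + δ)) {q : P2}
    (hq : IsWeightedHomogeneous μ q n) : IsWeightedHomogeneous μ (vf f q) (n + δ) := by
  have key : ∀ i, IsWeightedHomogeneous μ (f i * pderiv i q) (n + δ) := fun i => by
    have := (hf i).mul (hq.pderiv (i := i) (n' := n - μ i) (by ring))
    rwa [show μ i + δ + (n - μ i) = n + δ by ring] at this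
  exact (key 0).add (key 1)

lemma isWeightedHomogeneous_iterate_vf {μ : Fin 2 → ℚ} {f : Fin 2 → P2} {δ e : ℚ}
    (hf : ∀ j, IsWeightedHomogeneous μ (f j) (μ j + δ)) {q : P2}
    (hq : IsWeightedHomogeneous μ q e) (n : ℕ) :
    IsWeightedHomogeneous μ ((vf f)^[n] q) (e + n * δ) := by
  induction n with
  | zero => simpa using hq
  | succ n ih =>
    rw [Function.iterate_succ_apply']
    convert isWeightedHomogeneous_vf hf ih using 1
    push_cast
    ring

lemma isWeightedHomogeneous_vfHolDer {μ : Fin 2 → ℚ} {f : Fin 2 → P2} {δ n : ℚ}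
    (hf : ∀ j, IsWeightedHomogeneous μ (f j) (μ j + δ)) {q : P4}
    (hq : IsWeightedHomogeneous (Sum.elim μ 0) q n) :
    IsWeightedHomogeneous (Sum.elim μ 0) (vfHolDer f q) (n + δ) := by
  have key : ∀ i, IsWeightedHomogeneous (Sum.elim μ 0)
      (rename Sum.inl (f i) * pderiv (Sum.inl i) q) (n + δ) := fun i => by
    have h1 : IsWeightedHomogeneous (Sum.elim μ (0 : Fin 2 → ℚ)) (rename Sum.inl (f i) : P4)
      (μ i + δ) := IsWeightedHomogeneous.rename' (by simpa using hf i)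
    have := h1.mul (hq.pderiv (i := Sum.inl i) (n' := n - μ i) (by simp))
    rwa [show μ i + δ + (n - μ i) = n + δ by ring] at this
  rw [vfHolDer_apply]
  exact (key 0).add (key 1)

lemma isWeightedHomogeneous_zero_weight {σ : Type*} (q : MvPolynomial σ ℂ) :
    IsWeightedHomogeneous (0 : σ → ℚ) q 0 := by
  intro m _
  simp [Finsupp.weight_apply]

lemma isWeightedHomogeneous_vfBar {μ : Fin 2 → ℚ} {f : Fin 2 → P2} {n : ℚ} {q : P4}
    (hq : IsWeightedHomogeneous (Sum.elim μ 0) q n) :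
    IsWeightedHomogeneous (Sum.elim μ 0) (vfBar f q) n := by
  have key : ∀ i, IsWeightedHomogeneous (Sum.elim μ 0)
      (rename Sum.inr (map (starRingEnd ℂ) (f i)) * pderiv (Sum.inr i) q) n := fun i => by
    have h1 : IsWeightedHomogeneous (Sum.elim μ (0 : Fin 2 → ℚ))
        (rename Sum.inr (map (starRingEnd ℂ) (f i)) : P4) 0 :=
      IsWeightedHomogeneous.rename' (by simpa using isWeightedHomogeneous_zero_weight _)
    have := h1.mul (hq.pderiv (i := Sum.inr i) (n' := n) (by simp))
    rwa [zero_add] at this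
  exact (key 0).add (key 1)

end Bidegree

lemma iterate_vfBar_eq_zero_of_le {f : Fin 2 → P2} {R : P4} {i j : ℕ} (hij : i ≤ j)
    (h : (vfBar f)^[i] R = 0) : (vfBar f)^[j] R = 0 := by
  obtain ⟨n, rfl⟩ := Nat.exists_eq_add_of_le hij
  rw [add_comm, Function.iterate_add_apply, h, ← coe_vfBarDer, iterate_map_zero]

/-- The `z`-degree shifts of `Y` and `Ȳ` split `Y P + Ȳ P = 0` into components. -/
lemma vfBar_weightedHomogeneousComponent {μ : Fin 2 → ℚ} {f : Fin 2 → P2} {δ : ℚ}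
    (hf : ∀ j, IsWeightedHomogeneous μ (f j) (μ j + δ)) {P : P4}
    (hP : vfHolDer f P + vfBarDer f P = 0) (n : ℚ) :
    vfBar f (weightedHomogeneousComponent (Sum.elim μ 0) n P) =
      -vfHolDer f (weightedHomogeneousComponent (Sum.elim μ 0) (n - δ) P) := by
  have h1 := weightedHomogeneousComponent_comm (w := Sum.elim μ 0)
    (vfHolDer f : P4 →ₗ[ℂ] P4) δ (fun _ _ => isWeightedHomogeneous_vfHolDer hf) (n - δ) P
  have h2 := weightedHomogeneousComponent_comm (w := Sum.elim μ 0)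
    (vfBarDer f : P4 →ₗ[ℂ] P4) 0
    (fun n q hq => by
      rw [add_zero, Derivation.coeFn_coe, coe_vfBarDer]
      exact isWeightedHomogeneous_vfBar hq) n P
  rw [add_zero, Derivation.coeFn_coe] at h2
  rw [sub_add_cancel, Derivation.coeFn_coe] at h1
  rw [← h1, ← coe_vfBarDer, ← h2, eq_neg_of_add_eq_zero_right hP, map_neg]

/-- If `d` is the nilpotency order of `Ȳ` on a bihomogeneous polynomial `R`, then
`R = Q conj Q' + P̃` with `Q'` of nilpotency order `d` and `P̃` of nilpotency order less than `d`. -/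
lemma exists_eq_mul_conj_add {μ : Fin 2 → ℚ} {f : Fin 2 → P2} (hf0 : f ≠ 0) {δ : ℚ} (hδ : 0 < δ)
    (hf : ∀ j, IsWeightedHomogeneous μ (f j) (μ j + δ)) {c e : ℚ} (he : 0 < e) {R : P4}
    (hRc : IsWeightedHomogeneous (Sum.elim μ 0) R c)
    (hRe : IsWeightedHomogeneous (Sum.elim 0 μ) R e) {n : ℕ} (hn : (vfBar f)^[n] R ≠ 0)
    (hn1 : (vfBar f)^[n + 1] R = 0) :
    ∃ (Q Q' : P2) (Pt : P4), IsWeightedHomogeneous μ Q c ∧ IsWeightedHomogeneous μ Q' e ∧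
      IsWeightedHomogeneous (Sum.elim μ 0) Pt c ∧ IsWeightedHomogeneous (Sum.elim 0 μ) Pt e ∧
      R = rename Sum.inl Q * rename Sum.inr (map (starRingEnd ℂ) Q') + Pt ∧
      (vf f)^[n + 1] Q' = 0 ∧ (vf f)^[n] Q' ≠ 0 ∧ (vfBar f)^[n] Pt = 0 := by
  classical
  set S := sumAlgEquiv ℂ (Fin 2) (Fin 2) with hS
  set F : Fin 2 → P2 := fun i => map (starRingEnd ℂ) (f i) with hF
  have hF0 : F ≠ 0 := by
    intro h
    refine hf0 (funext fun i => ?_)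
    rw [← map_conj_map_conj (f i), show map (starRingEnd ℂ) (f i) = 0 from congrFun h i]
    simp
  have hFhom : ∀ j, IsWeightedHomogeneous μ (F j) (μ j + δ) := fun j => (hf j).map_conj
  have hA : ∀ a, IsWeightedHomogeneous μ (coeff a (S R)) e := by
    intro a b hb
    rw [hS, coeff_coeff_sumAlgEquiv] at hb
    rw [← aholDeg_sumElim μ a b, ← weight_zero_elim]
    exact hRe hb
  have hAc : ∀ a, coeff a (S R) ≠ 0 → Finsupp.weight μ a = c := by
    intro a ha
    obtain ⟨b, hb⟩ := ne_zero_iff.1 ha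
    rw [hS, coeff_coeff_sumAlgEquiv] at hb
    rw [← holDeg_sumElim μ a b, ← weight_elim_zero]
    exact hRc hb
  obtain ⟨a₀, ha₀⟩ : ∃ a, (vf F)^[n] (coeff a (S R)) ≠ 0 := by
    by_contra! h
    refine hn (S.injective (MvPolynomial.ext _ _ fun a => ?_))
    rw [hS, coeff_sumAlgEquiv_iterate_vfBar, h, map_zero, coeff_zero]
  have hker : ∀ a, vf F ((vf F)^[n] (coeff a (S R))) = 0 := by
    intro a
    rw [← Function.iterate_succ_apply' (vf F), ← coeff_sumAlgEquiv_iterate_vfBar, hn1, map_zero,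
      coeff_zero]
  have hr : ∀ a, ∃ r : ℂ, (vf F)^[n] (coeff a (S R)) = r • (vf F)^[n] (coeff a₀ (S R)) := fun a =>
    exists_eq_smul_of_vf_eq_zero hF0 (e := e + n * δ) (by positivity) ha₀
      (isWeightedHomogeneous_iterate_vf hFhom (hA _) n)
      (isWeightedHomogeneous_iterate_vf hFhom (hA _) n) (hker _) (hker _)
  choose r hr using hr
  have hr0 : ∀ a, coeff a (S R) = 0 → r a = 0 := by
    intro a ha
    have h := hr a
    rw [ha, ← coe_vfDer, iterate_map_zero, eq_comm, coe_vfDer] at h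
    exact (smul_eq_zero.1 h).resolve_right ha₀
  set Q : P2 := ∑ a ∈ (S R).support, monomial a (r a) with hQ
  have hQr : ∀ a, coeff a Q = r a := by
    intro a
    rw [hQ, coeff_sum]
    simp only [coeff_monomial, Finset.sum_ite_eq']
    split_ifs with h
    · rfl
    · exact (hr0 a (notMem_support_iff.1 h)).symm
  have hQc : IsWeightedHomogeneous μ Q c := by
    intro a ha
    rw [hQr] at ha
    exact hAc a fun h => ha (hr0 a h)
  have hprodc : IsWeightedHomogeneous (Sum.elim μ 0)
      (rename Sum.inl Q * rename Sum.inr (coeff a₀ (S R)) : P4) c := by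
    have h1 : IsWeightedHomogeneous (Sum.elim μ (0 : Fin 2 → ℚ)) (rename Sum.inl Q : P4) c :=
      IsWeightedHomogeneous.rename' (by simpa using hQc)
    have h2 : IsWeightedHomogeneous (Sum.elim μ (0 : Fin 2 → ℚ))
        (rename Sum.inr (coeff a₀ (S R)) : P4) 0 :=
      IsWeightedHomogeneous.rename' (by simpa using isWeightedHomogeneous_zero_weight _)
    simpa using h1.mul h2
  have hprode : IsWeightedHomogeneous (Sum.elim 0 μ)
      (rename Sum.inl Q * rename Sum.inr (coeff a₀ (S R)) : P4) e := by
    have h1 : IsWeightedHomogeneous (Sum.elim (0 : Fin 2 → ℚ) μ) (rename Sum.inl Q : P4) 0 :=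
      IsWeightedHomogeneous.rename' (by simpa using isWeightedHomogeneous_zero_weight _)
    have h2 : IsWeightedHomogeneous (Sum.elim (0 : Fin 2 → ℚ) μ)
        (rename Sum.inr (coeff a₀ (S R)) : P4) e :=
      IsWeightedHomogeneous.rename' (by simpa using hA a₀)
    simpa using h1.mul h2
  refine ⟨Q, map (starRingEnd ℂ) (coeff a₀ (S R)),
    R - rename Sum.inl Q * rename Sum.inr (coeff a₀ (S R)), hQc, (hA a₀).map_conj,
    hRc.sub hprodc, hRe.sub hprode, ?_, ?_, ?_, ?_⟩
  · rw [map_conj_map_conj]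
    ring
  · rw [iterate_vf_map_conj, Function.iterate_succ_apply', hker, map_zero]
  · rw [iterate_vf_map_conj]
    intro h
    refine ha₀ ?_
    rw [← map_conj_map_conj ((vf _)^[n] _), h, map_zero]
  · refine S.injective (MvPolynomial.ext _ _ fun a => ?_)
    have hiter : ∀ q, ((vfDer F : P2 →ₗ[ℂ] P2) ^ n) q = (vf F)^[n] q := fun q => by
      rw [Module.End.pow_apply, Derivation.coeFn_coe, coe_vfDer]
    rw [hS, coeff_sumAlgEquiv_iterate_vfBar, map_zero, coeff_zero, map_sub, map_mul,
      sumAlgEquiv_rename_inl, sumAlgEquiv_rename_inr, coeff_sub, mul_comm, coeff_C_mul, coeff_map,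
      hQr, mul_comm, ← smul_eq_C_mul, ← hF, ← hiter, map_sub, map_smul, hiter, hiter, ← hS, hr a,
      sub_self]

/-- for each bihomogeneous component `P_k` of `P` (collecting the
monomials of `P` whose `z`-part has weighted degree `c_k`, where
`c₁ < … < c_l` are the distinct `z`-degrees occurring in `P`), there are
`1 ≤ d_k ≤ k`, weighted homogeneous `Q_k, Q'_k` of weighted degrees `c_k`,
`1 - c_k` and a polynomial `P̃_k` of the same bidegree as `P_k` with
`P_k = Q_k · conj Q'_k + P̃_k`, `Y^{d_k}(Q'_k) = 0`, `Y^{d_k-1}(Q'_k) ≠ 0` and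
`Ȳ^{d_k-1}(P̃_k) = 0`. -/
theorem stmt11 (μ : Fin 2 → ℚ) (hμ0 : 0 < μ 1) (hμ12 : μ 1 ≤ μ 0) (hμ1 : μ 0 ≤ 1 / 2)
    (P : P4)
    (hreal : ∀ z : Fin 2 → ℂ, (eval (mix z) P).im = 0)
    (hPhom : IsWeightedHomogeneous (Sum.elim μ μ) P 1)
    (hplh : ∀ m ∈ P.support, (∃ i, m (Sum.inl i) ≠ 0) ∧ (∃ i, m (Sum.inr i) ≠ 0))
    -- `Y = f₁ ∂/∂z₁ + f₂ ∂/∂z₂` is a generalized rotation of `M_P`: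
    (f : Fin 2 → P2) (hf : f ≠ 0) (δ : ℚ) (hδ : 0 < δ)
    (hfhom : ∀ j, IsWeightedHomogeneous μ (f j) (μ j + δ))
    (htan : ∀ z : Fin 2 → ℂ,
      (eval z (f 0) * eval (mix z) (pderiv (Sum.inl 0) P) +
       eval z (f 1) * eval (mix z) (pderiv (Sum.inl 1) P)).re = 0)
    -- the bihomogeneous expansion `P = Σ_{k=1}^l P_k` with `c₁ < … < c_l`:
    (l : ℕ) (hl : 1 ≤ l) (c : ℕ → ℚ)
    (hmono : ∀ k k', 1 ≤ k → k < k' → k' ≤ l → c k < c k')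
    (Pk : ℕ → P4)
    (hPk : ∀ k, 1 ≤ k → k ≤ l →
      ∀ m, coeff m (Pk k) = if holDeg μ m = c k then coeff m P else 0)
    (hall : ∀ m ∈ P.support, ∃ k, 1 ≤ k ∧ k ≤ l ∧ holDeg μ m = c k)
    (hattain : ∀ k, 1 ≤ k → k ≤ l → ∃ m ∈ P.support, holDeg μ m = c k) :
    ∀ k, 1 ≤ k → k ≤ l →
      ∃ (dk : ℕ) (Q Q' : P2) (Pt : P4),
        1 ≤ dk ∧ dk ≤ k ∧
        IsWeightedHomogeneous μ Q (c k) ∧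
        IsWeightedHomogeneous μ Q' (1 - c k) ∧
        -- `P̃_k` has the same bidegree as `P_k`:
        (∀ m ∈ Pt.support, holDeg μ m = c k ∧ aholDeg μ m = 1 - c k) ∧
        -- `P_k = Q_k · conj Q'_k + P̃_k`:
        (∀ z : Fin 2 → ℂ,
          eval (mix z) (Pk k) =
            eval z Q * (starRingEnd ℂ) (eval z Q') + eval (mix z) Pt) ∧
        (vf f)^[dk] Q' = 0 ∧
        (vf f)^[dk - 1] Q' ≠ 0 ∧
        (vfBar f)^[dk - 1] Pt = 0 := by
  have hsum := vfHolDer_add_vfBarDer_eq_zero hreal htan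
  have hcomp : ∀ k, 1 ≤ k → k ≤ l →
      Pk k = weightedHomogeneousComponent (Sum.elim μ 0) (c k) P := by
    intro k hk1 hkl
    refine MvPolynomial.ext _ _ fun m => ?_
    rw [hPk k hk1 hkl, coeff_weightedHomogeneousComponent, weight_elim_zero]
  have hnil : ∀ k, 1 ≤ k → k ≤ l → (vfBar f)^[k] (Pk k) = 0 := by
    intro k
    induction k using Nat.strong_induction_on with
    | _ k ih =>
      intro hk1 hkl
      obtain ⟨n, rfl⟩ := Nat.exists_eq_add_of_le' hk1
      set R := weightedHomogeneousComponent (Sum.elim μ 0) (c (n + 1) - δ) P with hR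
      have hRn : (vfBar f)^[n] R = 0 := by
        by_cases hR0 : R = 0
        · rw [hR0, ← coe_vfBarDer, iterate_map_zero]
        · obtain ⟨m, hm⟩ := ne_zero_iff.1 hR0
          rw [hR, coeff_weightedHomogeneousComponent, weight_elim_zero] at hm
          obtain ⟨hmc, hmP⟩ := ite_ne_right_iff.1 hm
          obtain ⟨j, hj1, hjl, hj⟩ := hall m (mem_support_iff.2 hmP)
          have hjk : j < n + 1 := by
            by_contra! hle
            rcases hle.eq_or_lt with rfl | hlt
            · linarith
            · have := hmono _ _ hk1 hlt hjl
              linarith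
          have hjR : R = Pk j := by rw [hcomp j hj1 hjl, hR, ← hmc, hj]
          rw [hjR]
          exact iterate_vfBar_eq_zero_of_le (Nat.lt_succ_iff.1 hjk) (ih j hjk hj1 hjl)
      have hcomm : Function.Commute (vfBar f) (vfHolDer f) := fun q => by
        rw [← coe_vfBarDer, vfHolDer_vfBarDer_comm]
      rw [Function.iterate_succ_apply, hcomp _ hk1 hkl,
        vfBar_weightedHomogeneousComponent hfhom hsum, ← hR, ← map_neg,
        (hcomm.iterate_left n).eq, ← coe_vfBarDer, iterate_map_neg, coe_vfBarDer, hRn, neg_zero,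
        map_zero]
  intro k hk1 hkl
  have hRc : IsWeightedHomogeneous (Sum.elim μ 0) (Pk k) (c k) := by
    rw [hcomp k hk1 hkl]
    exact weightedHomogeneousComponent_isWeightedHomogeneous _ _
  have hRe : IsWeightedHomogeneous (Sum.elim 0 μ) (Pk k) (1 - c k) := by
    intro m hm
    rw [hPk k hk1 hkl] at hm
    obtain ⟨hmc, hmP⟩ := ite_ne_right_iff.1 hm
    have := hPhom hmP
    rw [weight_elim_elim] at this
    rw [weight_zero_elim]
    linarith
  obtain ⟨m, hmP, hmc⟩ := hattain k hk1 hkl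
  have hmk : coeff m (Pk k) ≠ 0 := by
    rw [hPk k hk1 hkl, if_pos hmc]
    exact mem_support_iff.1 hmP
  have he : 0 < 1 - c k := by
    rw [← hRe hmk, weight_zero_elim, aholDeg]
    have hμ : 0 < μ 0 := hμ0.trans_le hμ12
    obtain ⟨i, hi⟩ := (hplh m hmP).2
    have hi' : (0 : ℚ) < m (Sum.inr i) := by exact_mod_cast Nat.pos_of_ne_zero hi
    fin_cases i
    · exact add_pos_of_pos_of_nonneg (mul_pos hi' hμ) (by positivity)
    · exact add_pos_of_nonneg_of_pos (by positivity) (mul_pos hi' hμ0)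
  have hex : ∃ d, (vfBar f)^[d] (Pk k) = 0 := ⟨k, hnil k hk1 hkl⟩
  classical
  obtain ⟨n, hn⟩ : ∃ n, Nat.find hex = n + 1 := by
    refine Nat.exists_eq_succ_of_ne_zero fun h => hmk ?_
    have := Nat.find_spec hex
    rw [h, Function.iterate_zero_apply] at this
    rw [this, coeff_zero]
  have hn1 : (vfBar f)^[n + 1] (Pk k) = 0 := hn ▸ Nat.find_spec hex
  have hn0 : (vfBar f)^[n] (Pk k) ≠ 0 := Nat.find_min hex (by lia)
  obtain ⟨Q, Q', Pt, hQ, hQ', hPtc, hPte, heq, h1, h2, h3⟩ :=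
    exists_eq_mul_conj_add hf hδ hfhom he hRc hRe hn0 hn1
  refine ⟨n + 1, Q, Q', Pt, by lia, hn ▸ Nat.find_min' hex (hnil k hk1 hkl), hQ, hQ', ?_, ?_,
    h1, h2, h3⟩
  · intro m hm
    rw [← weight_elim_zero, ← weight_zero_elim]
    exact ⟨hPtc (mem_support_iff.1 hm), hPte (mem_support_iff.1 hm)⟩
  · intro z
    rw [heq, map_add, map_mul, eval_mix_rename_inl, eval_mix_rename_inr]
end
end
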